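/- For every integer n ≥ 4 with n ≡ 1 (mod 3), the composite permutation σ∘α of the map M_n is a single cycle on all 2(8n−5)/3 darts; that is, M_n has exactly one face. Consequently, since M_n has 2n vertices and (8n−5)/3 edges, its Euler genus (2 − V + E − F)/2 equals (n−1)/3. -/

import Mathlib

/-- The number of cycles (orbits) of a permutation `σ` of `D`: the number of
equivalence classes of the "same cycle" relation of `σ` (fixed points count
as 1-cycles). For a combinatorial map `(D, σ, α)`, the vertices are the cycles
of `σ` and the faces are the cycles of `σ ∘ α`. -/
noncomputable def numCycles {D : Type*} (σ : Equiv.Perm D) : ℕ :=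
  Nat.card (Quotient (Setoid.mk σ.SameCycle
    ⟨fun x => Equiv.Perm.SameCycle.refl σ x,
     fun h => h.symm,
     fun h h' => h.trans h'⟩))

/-- The edges of the map `M_n`, where `n = 3q + 4` and
`S = {3, 6, …, n-1} = {3(l+1) : l : Fin (q+1)}`; there are `(8n-5)/3 = 8q + 9`
of them, listed by the eight constructors `MP, MU, MU', MW, MW', ME, Ms, Mt`
below. -/
abbrev MEdge (q : ℕ) :=
  Fin (q + 2) ⊕ Fin (q + 1) ⊕ Fin (q + 1) ⊕ Fin (q + 1) ⊕ Fin (q + 1) ⊕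
    Fin (q + 1) ⊕ Fin (q + 1) ⊕ Fin (q + 1)

/-- The edge `P_?` of `M_n` for `p : Fin (q+2)`: `MP 0` is `P_0 = d_3 v_1`;
`MP p` for `1 ≤ p ≤ q` is `P_{3p} = d_{3p+3} d_{3p}`; and `MP (q+1)` is
`P_{n-1} = b d_{n-1}`. Its `false` dart is at the endpoint closer to `b`
(namely `b` for `MP (q+1)` and `d_{3p+3}` otherwise), and its `true` dart is at
the other endpoint (`d_{3p}`, or `v_1` for `P_0`). -/
def MP {q : ℕ} (p : Fin (q + 2)) : MEdge q := Sum.inl p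

/-- The edge `U_i = b a_i` of `M_n`, where `i = 3(l+1) ∈ S`; `false` dart at
`b`, `true` dart at `a_i`. -/
def MU {q : ℕ} (l : Fin (q + 1)) : MEdge q := Sum.inr (Sum.inl l)

/-- The edge `U′_i = a_i v_{i+1}` of `M_n`, where `i = 3(l+1) ∈ S`; `false`
dart at `a_i`, `true` dart at `v_{i+1}`. -/
def MU' {q : ℕ} (l : Fin (q + 1)) : MEdge q := Sum.inr (Sum.inr (Sum.inl l))

/-- The edge `W_i = b c_i` of `M_n`, where `i = 3(l+1) ∈ S`; `false` dart at
`b`, `true` dart at `c_i`. -/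
def MW {q : ℕ} (l : Fin (q + 1)) : MEdge q :=
  Sum.inr (Sum.inr (Sum.inr (Sum.inl l)))

/-- The edge `W′_i = c_i v_{i-1}` of `M_n`, where `i = 3(l+1) ∈ S`; `false`
dart at `c_i`, `true` dart at `v_{i-1}`. -/
def MW' {q : ℕ} (l : Fin (q + 1)) : MEdge q :=
  Sum.inr (Sum.inr (Sum.inr (Sum.inr (Sum.inl l))))

/-- The edge `E_i = b v_i` of `M_n`, where `i = 3(l+1) ∈ S`; `false` dart at
`b`, `true` dart at `v_i`. -/
def ME {q : ℕ} (l : Fin (q + 1)) : MEdge q :=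
  Sum.inr (Sum.inr (Sum.inr (Sum.inr (Sum.inr (Sum.inl l)))))

/-- The edge `s_i = a_i c_i` of `M_n`, where `i = 3(l+1) ∈ S`; `false` dart at
`a_i`, `true` dart at `c_i`. -/
def Ms {q : ℕ} (l : Fin (q + 1)) : MEdge q :=
  Sum.inr (Sum.inr (Sum.inr (Sum.inr (Sum.inr (Sum.inr (Sum.inl l))))))

/-- The edge `t_i = d_i v_i` of `M_n`, where `i = 3(l+1) ∈ S`; `false` dart at
`d_i`, `true` dart at `v_i`. -/
def Mt {q : ℕ} (l : Fin (q + 1)) : MEdge q :=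
  Sum.inr (Sum.inr (Sum.inr (Sum.inr (Sum.inr (Sum.inr (Sum.inr l))))))

/-- The darts of `M_n`: each edge carries two darts, `false` and `true`, as
described in the docstrings of `MP, MU, MU', MW, MW', ME, Ms, Mt`. -/
abbrev MDart (q : ℕ) := MEdge q × Bool

/-- The edge involution `α` of `M_n`: it exchanges the two darts of each edge. -/
def dartFlip {E : Type*} : Equiv.Perm (E × Bool) :=
  Equiv.prodCongr (Equiv.refl E) ⟨not, not, Bool.not_not, Bool.not_not⟩

theorem MDart_cases {q : ℕ} {motive : MDart q → Prop}
    (hPf : ∀ l : Fin (q + 1), motive (MP l.castSucc, false))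
    (hPl : motive (MP (Fin.last (q + 1)), false))
    (hPt : ∀ l : Fin (q + 1), motive (MP l.succ, true))
    (hP0 : motive (MP 0, true))
    (hU : ∀ l b, motive (MU l, b)) (hU' : ∀ l b, motive (MU' l, b))
    (hW : ∀ l b, motive (MW l, b)) (hW' : ∀ l b, motive (MW' l, b))
    (hE : ∀ l b, motive (ME l, b)) (hs : ∀ l b, motive (Ms l, b))
    (ht : ∀ l b, motive (Mt l, b)) (x : MDart q) : motive x := by
  obtain ⟨e, b⟩ := x
  rcases e with p | l | l | l | l | l | l | l
  · cases b with
    | false =>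
      induction p using Fin.lastCases with
      | last => exact hPl
      | cast l => exact hPf l
    | true =>
      induction p using Fin.cases with
      | zero => exact hP0
      | succ l => exact hPt l
  · exact hU l b
  · exact hU' l b
  · exact hW l b
  · exact hW' l b
  · exact hE l b
  · exact hs l b
  · exact ht l b

/-- Vertices: `none` is `b`, `some none` is `v_1`, `some (some (k, l))` is, for `i = 3(l+1)`,
`a_i, c_i, d_i, v_i, v_{i+1}, v_{i-1}` for `k = 0, …, 5`. -/
abbrev MVert (q : ℕ) := Option (Option (Fin 6 × Fin (q + 1)))

/-- The vertex of a dart. -/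
def vertOf {q : ℕ} : MDart q → MVert q
  | (Sum.inl p, false) =>
      Fin.lastCases (motive := fun _ => MVert q) none (fun l => some (some (2, l))) p
  | (Sum.inl p, true) =>
      Fin.cases (motive := fun _ => MVert q) (some none) (fun l => some (some (2, l))) p
  | (Sum.inr (Sum.inl _), false) => none
  | (Sum.inr (Sum.inl l), true) => some (some (0, l))
  | (Sum.inr (Sum.inr (Sum.inl l)), false) => some (some (0, l))
  | (Sum.inr (Sum.inr (Sum.inl l)), true) => some (some (4, l))
  | (Sum.inr (Sum.inr (Sum.inr (Sum.inl _))), false) => none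
  | (Sum.inr (Sum.inr (Sum.inr (Sum.inl l))), true) => some (some (1, l))
  | (Sum.inr (Sum.inr (Sum.inr (Sum.inr (Sum.inl l)))), false) => some (some (1, l))
  | (Sum.inr (Sum.inr (Sum.inr (Sum.inr (Sum.inl l)))), true) => some (some (5, l))
  | (Sum.inr (Sum.inr (Sum.inr (Sum.inr (Sum.inr (Sum.inl _))))), false) => none
  | (Sum.inr (Sum.inr (Sum.inr (Sum.inr (Sum.inr (Sum.inl l))))), true) => some (some (3, l))
  | (Sum.inr (Sum.inr (Sum.inr (Sum.inr (Sum.inr (Sum.inr (Sum.inl l)))))), false) =>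
      some (some (0, l))
  | (Sum.inr (Sum.inr (Sum.inr (Sum.inr (Sum.inr (Sum.inr (Sum.inl l)))))), true) =>
      some (some (1, l))
  | (Sum.inr (Sum.inr (Sum.inr (Sum.inr (Sum.inr (Sum.inr (Sum.inr l)))))), false) =>
      some (some (2, l))
  | (Sum.inr (Sum.inr (Sum.inr (Sum.inr (Sum.inr (Sum.inr (Sum.inr l)))))), true) =>
      some (some (3, l))

/-- A representative dart at each vertex. -/
def vertRep {q : ℕ} : MVert q → MDart q
  | none => (MP (Fin.last (q + 1)), false)
  | some none => (MP 0, true)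
  | some (some (0, l)) => (MU l, true)
  | some (some (1, l)) => (MW l, true)
  | some (some (2, l)) => (Mt l, false)
  | some (some (3, l)) => (ME l, true)
  | some (some (4, l)) => (MU' l, true)
  | some (some (5, l)) => (MW' l, true)

theorem vertOf_P_cast {q : ℕ} (l : Fin (q + 1)) :
    vertOf (MP l.castSucc, false) = some (some (2, l)) := by
  simp [vertOf, MP]

theorem vertOf_P_last {q : ℕ} :
    vertOf (MP (Fin.last (q + 1)), false) = none := by
  simp [vertOf, MP]

theorem vertOf_vertRep {q : ℕ} (v : MVert q) : vertOf (vertRep v) = v := by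
  rcases v with _ | _ | ⟨k, l⟩
  · exact vertOf_P_last
  · rfl
  · fin_cases k <;> rfl

/-- If a function is invariant under `σ` and every point is in the cycle of a section of that
function, then the values count the cycles. -/
theorem numCycles_eq_card {D V : Type*} (σ : Equiv.Perm D) (f : D → V) (r : V → D)
    (hf : ∀ x, f (σ x) = f x) (hfr : ∀ v, f (r v) = v)
    (hr : ∀ x, σ.SameCycle (r (f x)) x) : numCycles σ = Nat.card V := by
  have hpow : ∀ (k : ℕ) x, f ((σ ^ k) x) = f x := by
    intro k
    induction k with
    | zero => intro x; rfl
    | succ k ih => intro x; rw [pow_succ, Equiv.Perm.mul_apply, ih, hf]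
  have hsc : ∀ x y, σ.SameCycle x y → f x = f y := by
    rintro x y ⟨k, rfl⟩
    cases k with
    | ofNat k => exact (hpow k x).symm
    | negSucc k =>
      have h := hpow (k + 1) ((σ ^ (Int.negSucc k)) x)
      rw [zpow_negSucc, ← Equiv.Perm.mul_apply, mul_inv_cancel, Equiv.Perm.one_apply] at h
      rw [zpow_negSucc]
      exact h
  unfold numCycles
  refine Nat.card_congr
    { toFun := Quotient.lift f hsc
      invFun := fun v => Quotient.mk _ (r v)
      left_inv := ?_
      right_inv := fun v => hfr v }
  intro x
  induction x using Quotient.inductionOn with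
  | h x => exact Quotient.sound (hr x)

/-- For every `n ≥ 4` with `n ≡ 1 (mod 3)` (written `n = 3q + 4`),
the composite permutation `σ ∘ α` of the map `M_n` is a single cycle on all
`2(8n-5)/3` darts, i.e. `M_n` has exactly one face; consequently (as `M_n` has
`2n` vertices and `(8n-5)/3` edges) its Euler genus `(2 - V + E - F)/2` equals
`(n-1)/3`.

Here `σ` is the rotation of `M_n`, specified by the hypotheses (with
`i = 3(l+1)` ranging over `S = {3, 6, …, n-1}`): at `b` it is the single cycle
running, for `j = n, n-1, …, 2` in this order, through `(b,U_{j-1})` if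
`j ≡ 1 (mod 3)`, `(b,E_j)` if `j ≡ 0 (mod 3)`, `(b,W_{j+1})` if `j ≡ 2 (mod 3)`,
followed finally by `(b,P_{n-1})`; at each `a_i` it is the 3-cycle
`(a_i,U_i) → (a_i,U′_i) → (a_i,s_i) → (a_i,U_i)`; at each `c_i` it is the
3-cycle `(c_i,W_i) → (c_i,s_i) → (c_i,W′_i) → (c_i,W_i)`; at each `d_i` it is
the 3-cycle `(d_i,β_i) → (d_i,γ_i) → (d_i,t_i) → (d_i,β_i)`, where `β_i` is
the dart at `d_i` of the `P`-edge on the `b`-side and `γ_i` the dart at `d_i`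
of the `P`-edge on the `v_1`-side; at each `v_i` with `i ∈ S` it exchanges
`(v_i,E_i)` and `(v_i,t_i)`; and it fixes the unique dart at every remaining
vertex `v_j`. -/
theorem M_map_one_face (q n : ℕ) (hn : n = 3 * q + 4)
    (σ : Equiv.Perm (MDart q))
    -- at b: (b,U_{j-1}) ↦ (b,E_{j-1})   (j ≡ 1 mod 3; both darts have index l)
    (hb1 : ∀ l : Fin (q + 1), σ (MU l, false) = (ME l, false))
    -- at b: (b,E_j) ↦ (b,W_j)           (j ≡ 0 mod 3; both darts have index l)
    (hb2 : ∀ l : Fin (q + 1), σ (ME l, false) = (MW l, false))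
    -- at b: (b,W_{j+1}) ↦ (b,U_{j-2})   (j ≡ 2 mod 3; index l+1 to index l)
    (hb3 : ∀ l : Fin q, σ (MW l.succ, false) = (MU l.castSucc, false))
    -- at b: (b,W_3) ↦ (b,P_{n-1})
    (hb4 : σ (MW 0, false) = (MP (Fin.last (q + 1)), false))
    -- at b: (b,P_{n-1}) ↦ (b,U_{n-1})
    (hb5 : σ (MP (Fin.last (q + 1)), false) = (MU (Fin.last q), false))
    -- at a_i: (a_i,U_i) ↦ (a_i,U′_i)
    (ha1 : ∀ l : Fin (q + 1), σ (MU l, true) = (MU' l, false))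
    -- at a_i: (a_i,U′_i) ↦ (a_i,s_i)
    (ha2 : ∀ l : Fin (q + 1), σ (MU' l, false) = (Ms l, false))
    -- at a_i: (a_i,s_i) ↦ (a_i,U_i)
    (ha3 : ∀ l : Fin (q + 1), σ (Ms l, false) = (MU l, true))
    -- at c_i: (c_i,W_i) ↦ (c_i,s_i)
    (hc1 : ∀ l : Fin (q + 1), σ (MW l, true) = (Ms l, true))
    -- at c_i: (c_i,s_i) ↦ (c_i,W′_i)
    (hc2 : ∀ l : Fin (q + 1), σ (Ms l, true) = (MW' l, false))
    -- at c_i: (c_i,W′_i) ↦ (c_i,W_i)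
    (hc3 : ∀ l : Fin (q + 1), σ (MW' l, false) = (MW l, true))
    -- at d_i: (d_i,β_i) ↦ (d_i,γ_i), where β_i is the dart of the P-edge on the
    -- b-side (the true dart of MP (l+1)) and γ_i the dart of the P-edge on the
    -- v_1-side (the false dart of MP l)
    (hd1 : ∀ l : Fin (q + 1), σ (MP l.succ, true) = (MP l.castSucc, false))
    -- at d_i: (d_i,γ_i) ↦ (d_i,t_i)
    (hd2 : ∀ l : Fin (q + 1), σ (MP l.castSucc, false) = (Mt l, false))
    -- at d_i: (d_i,t_i) ↦ (d_i,β_i)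
    (hd3 : ∀ l : Fin (q + 1), σ (Mt l, false) = (MP l.succ, true))
    -- at v_i (i ∈ S): exchange (v_i,E_i) and (v_i,t_i)
    (hva : ∀ l : Fin (q + 1), σ (ME l, true) = (Mt l, true))
    (hvb : ∀ l : Fin (q + 1), σ (Mt l, true) = (ME l, true))
    -- σ fixes the unique dart at v_1 (the dart of P_0 at v_1)
    (hv1 : σ (MP 0, true) = (MP 0, true))
    -- σ fixes the unique dart at each v_{i+1}, i ∈ S (the dart of U′_i there)
    (hv2 : ∀ l : Fin (q + 1), σ (MU' l, true) = (MU' l, true))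
    -- σ fixes the unique dart at each v_{i-1}, i ∈ S (the dart of W′_i there)
    (hv3 : ∀ l : Fin (q + 1), σ (MW' l, true) = (MW' l, true)) :
    (∀ x y : MDart q, (σ * dartFlip).SameCycle x y) ∧
      numCycles (σ * dartFlip) = 1 ∧
      (2 - (numCycles σ : ℤ) + (8 * (n : ℤ) - 5) / 3 - (numCycles (σ * dartFlip) : ℤ)) / 2
        = ((n : ℤ) - 1) / 3 := by
  classical
  -- the face permutation
  have fl : ∀ (e : MEdge q) (b : Bool), (σ * dartFlip : Equiv.Perm (MDart q)) (e, b) = σ (e, !b) := fun _ _ => rfl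
  have face : ∀ x y : MDart q, (σ * dartFlip).SameCycle x y := by
    generalize hφ : σ * dartFlip = φ at fl
    have st : ∀ {e : MEdge q} {b : Bool} {y : MDart q}, σ (e, !b) = y → φ.SameCycle (e, b) y := by
      intro e b y h
      rw [← h, ← fl]
      exact Equiv.Perm.sameCycle_apply_right.2 (Equiv.Perm.SameCycle.refl _ _)
    -- stretch along `t, E, W, s, U, E, t`
    have h1 : ∀ l, φ.SameCycle (MP l.castSucc, true) (Mt l, false) := fun l => st (hd2 l)
    have h2 : ∀ l, φ.SameCycle (Mt l, false) (ME l, true) := fun l => st (hvb l)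
    have h3 : ∀ l, φ.SameCycle (ME l, true) (MW l, false) := fun l => st (hb2 l)
    have h4 : ∀ l, φ.SameCycle (MW l, false) (Ms l, true) := fun l => st (hc1 l)
    have h5 : ∀ l, φ.SameCycle (Ms l, true) (MU l, true) := fun l => st (ha3 l)
    have h6 : ∀ l, φ.SameCycle (MU l, true) (ME l, false) := fun l => st (hb1 l)
    have h7 : ∀ l, φ.SameCycle (ME l, false) (Mt l, true) := fun l => st (hva l)
    have h8 : ∀ l, φ.SameCycle (Mt l, true) (MP l.succ, true) := fun l => st (hd3 l)
    have hlast : φ.SameCycle (MP (Fin.last (q + 1)), true) (MU (Fin.last q), false) := st hb5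
    have g1 : ∀ l, φ.SameCycle (MU l, false) (MU' l, false) := fun l => st (ha1 l)
    have g2 : ∀ l, φ.SameCycle (MU' l, false) (MU' l, true) := fun l => st (hv2 l)
    have g3 : ∀ l, φ.SameCycle (MU' l, true) (Ms l, false) := fun l => st (ha2 l)
    have g4 : ∀ l, φ.SameCycle (Ms l, false) (MW' l, false) := fun l => st (hc2 l)
    have g5 : ∀ l, φ.SameCycle (MW' l, false) (MW' l, true) := fun l => st (hv3 l)
    have g6 : ∀ l, φ.SameCycle (MW' l, true) (MW l, true) := fun l => st (hc3 l)
    have g7 : ∀ l : Fin q, φ.SameCycle (MW l.succ, true) (MU l.castSucc, false) :=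
      fun l => st (hb3 l)
    have k1 : ∀ l : Fin (q + 1), φ.SameCycle (MP l.succ, false) (MP l.castSucc, false) :=
      fun l => st (hd1 l)
    have k2 : φ.SameCycle (MP 0, false) (MP 0, true) := st hv1
    -- everything is in the cycle of `(MP 0, true)`
    have PT : ∀ p, φ.SameCycle (MP 0, true) (MP p, true) := by
      intro p
      induction p using Fin.induction with
      | zero => exact Equiv.Perm.SameCycle.refl _ _
      | succ l ih =>
        exact ih.trans ((h1 l).trans ((h2 l).trans ((h3 l).trans ((h4 l).trans ((h5 l).trans
          ((h6 l).trans ((h7 l).trans (h8 l))))))))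
    have PF : ∀ p, φ.SameCycle (MP 0, true) (MP p, false) := by
      intro p
      induction p using Fin.induction with
      | zero => exact k2.symm
      | succ l ih => exact ih.trans (k1 l).symm
    have T0 : ∀ l, φ.SameCycle (MP 0, true) (Mt l, false) := fun l => (PT _).trans (h1 l)
    have E1 : ∀ l, φ.SameCycle (MP 0, true) (ME l, true) := fun l => (T0 l).trans (h2 l)
    have W0 : ∀ l, φ.SameCycle (MP 0, true) (MW l, false) := fun l => (E1 l).trans (h3 l)
    have S1 : ∀ l, φ.SameCycle (MP 0, true) (Ms l, true) := fun l => (W0 l).trans (h4 l)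
    have U1 : ∀ l, φ.SameCycle (MP 0, true) (MU l, true) := fun l => (S1 l).trans (h5 l)
    have E0 : ∀ l, φ.SameCycle (MP 0, true) (ME l, false) := fun l => (U1 l).trans (h6 l)
    have T1 : ∀ l, φ.SameCycle (MP 0, true) (Mt l, true) := fun l => (E0 l).trans (h7 l)
    have UW : ∀ l, φ.SameCycle (MU l, false) (MW l, true) := fun l =>
      (g1 l).trans ((g2 l).trans ((g3 l).trans ((g4 l).trans ((g5 l).trans (g6 l)))))
    have U0 : ∀ l, φ.SameCycle (MP 0, true) (MU l, false) := by
      intro l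
      induction l using Fin.reverseInduction with
      | last => exact (PT _).trans hlast
      | cast l ih => exact ih.trans ((UW _).trans (g7 l))
    have Ua0 : ∀ l, φ.SameCycle (MP 0, true) (MU' l, false) := fun l => (U0 l).trans (g1 l)
    have Ua1 : ∀ l, φ.SameCycle (MP 0, true) (MU' l, true) := fun l => (Ua0 l).trans (g2 l)
    have S0 : ∀ l, φ.SameCycle (MP 0, true) (Ms l, false) := fun l => (Ua1 l).trans (g3 l)
    have Wa0 : ∀ l, φ.SameCycle (MP 0, true) (MW' l, false) := fun l => (S0 l).trans (g4 l)
    have Wa1 : ∀ l, φ.SameCycle (MP 0, true) (MW' l, true) := fun l => (Wa0 l).trans (g5 l)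
    have W1 : ∀ l, φ.SameCycle (MP 0, true) (MW l, true) := fun l => (Wa1 l).trans (g6 l)
    have all : ∀ x, φ.SameCycle (MP 0, true) x := by
      intro x
      induction x using MDart_cases with
      | hPf l => exact PF _
      | hPl => exact PF _
      | hPt l => exact PT _
      | hP0 => exact PT _
      | hU l b => cases b; exacts [U0 l, U1 l]
      | hU' l b => cases b; exacts [Ua0 l, Ua1 l]
      | hW l b => cases b; exacts [W0 l, W1 l]
      | hW' l b => cases b; exacts [Wa0 l, Wa1 l]
      | hE l b => cases b; exacts [E0 l, E1 l]
      | hs l b => cases b; exacts [S0 l, S1 l]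
      | ht l b => cases b; exacts [T0 l, T1 l]
    exact fun x y => (all x).symm.trans (all y)
  have one : numCycles (σ * dartFlip) = 1 := by
    rw [numCycles_eq_card (σ * dartFlip) (fun _ => ()) (fun _ => (MP 0, true))
      (fun _ => rfl) (fun _ => rfl) (fun x => face _ x)]
    simp
  have verts : numCycles σ = 6 * q + 8 := by
    have inv : ∀ x, vertOf (σ x) = vertOf x := by
      intro x
      induction x using MDart_cases with
      | hPf l => rw [hd2, vertOf_P_cast]; rfl
      | hPl => rw [hb5, vertOf_P_last]; rfl
      | hPt l => rw [hd1, vertOf_P_cast]; rfl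
      | hP0 => rw [hv1]
      | hU l b => cases b; exacts [by rw [hb1]; rfl, by rw [ha1]; rfl]
      | hU' l b => cases b; exacts [by rw [ha2]; rfl, by rw [hv2]]
      | hW l b =>
        cases b with
        | false =>
          induction l using Fin.cases with
          | zero => rw [hb4, vertOf_P_last]; rfl
          | succ l => rw [hb3]; rfl
        | true => rw [hc1]; rfl
      | hW' l b => cases b; exacts [by rw [hc3]; rfl, by rw [hv3]]
      | hE l b => cases b; exacts [by rw [hb2]; rfl, by rw [hva]; rfl]
      | hs l b => cases b; exacts [by rw [ha3]; rfl, by rw [hc2]; rfl]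
      | ht l b => cases b; exacts [by rw [hd3]; rfl, by rw [hvb]; rfl]
    have st : ∀ {x y : MDart q}, σ x = y → σ.SameCycle x y := by
      intro x y h
      rw [← h]
      exact Equiv.Perm.sameCycle_apply_right.2 (Equiv.Perm.SameCycle.refl _ _)
    have UW : ∀ l, σ.SameCycle (MU l, false) (MW l, false) := fun l =>
      (st (hb1 l)).trans (st (hb2 l))
    have U0 : ∀ l, σ.SameCycle (MP (Fin.last (q + 1)), false) (MU l, false) := by
      intro l
      induction l using Fin.reverseInduction with
      | last => exact st hb5
      | cast l ih => exact ih.trans ((UW _).trans (st (hb3 l)))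
    have rep : ∀ x, σ.SameCycle (vertRep (vertOf x)) x := by
      intro x
      induction x using MDart_cases with
      | hPf l => rw [vertOf_P_cast]; exact (st (hd2 l)).symm
      | hPl => rw [vertOf_P_last]; exact Equiv.Perm.SameCycle.refl _ _
      | hPt l => exact st (hd3 l)
      | hP0 => exact Equiv.Perm.SameCycle.refl _ _
      | hU l b => cases b; exacts [U0 l, Equiv.Perm.SameCycle.refl _ _]
      | hU' l b => cases b; exacts [st (ha1 l), Equiv.Perm.SameCycle.refl _ _]
      | hW l b => cases b; exacts [(U0 l).trans (UW l), Equiv.Perm.SameCycle.refl _ _]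
      | hW' l b => cases b; exacts [(st (hc3 l)).symm, Equiv.Perm.SameCycle.refl _ _]
      | hE l b => cases b; exacts [(U0 l).trans (st (hb1 l)), Equiv.Perm.SameCycle.refl _ _]
      | hs l b => cases b; exacts [(st (ha3 l)).symm, st (hc1 l)]
      | ht l b => cases b; exacts [Equiv.Perm.SameCycle.refl _ _, st (hva l)]
    rw [numCycles_eq_card σ vertOf vertRep inv vertOf_vertRep rep]
    simp only [Nat.card_eq_fintype_card, Fintype.card_option, Fintype.card_prod, Fintype.card_fin]
    ring
  refine ⟨face, one, ?_⟩
  rw [one, verts, hn]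
  push_cast
  omega
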